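/- Let d ≥ 2, 0 < β ≤ 1, Q > 0, p ∈ [1, ∞), and K ≥ 1. For every f: [0,1]^d → ℝ with |f(x) − f(y)| ≤ Q‖x − y‖_∞^β, there exists a function f̃: [0,1]^d → ℝ realizable as a deep ReLU network (with K+3 hidden layers, widths as specified) such that ‖f − f̃‖_{L^p([0,1]^d)} ≤ (16Q + 2‖f‖_∞) · 2^{-βK}. In particular, f̃ agrees with the truncated KA approximation g(∑_p 3^{-p} φ_K(x_p)) outside a set of Lebesgue measure at most d·2^{-Kβp}, and is bounded by ‖f‖_∞ everywhere. -/

import Mathlib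

open Set Filter Topology MeasureTheory

noncomputable section

/-- The unit cube `[0,1]^d`. -/
def cube (d : ℕ) : Set (Fin d → ℝ) := {x | ∀ p, x p ∈ Set.Icc (0:ℝ) 1}

/-- The Cantor middle-thirds set: reals admitting a ternary expansion with digits in `{0,2}`. -/
def CantorSet : Set ℝ :=
  {y | ∃ t : ℕ → ℕ, (∀ j, t j = 0 ∨ t j = 2) ∧ y = ∑' j : ℕ, (t j : ℝ) / 3 ^ (j + 1)}

/-- `a` assigns to each `x ∈ [0,1]` a fixed binary expansion (`a x j` is the digit `a_{j+1}^x`). -/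
def IsBinaryExp (a : ℝ → ℕ → ℕ) : Prop :=
  ∀ x ∈ Set.Icc (0:ℝ) 1, (∀ j, a x j ≤ 1) ∧ x = ∑' j : ℕ, (a x j : ℝ) / 2 ^ (j + 1)

/-- `φ(x) = ∑_{j≥1} 2 a_j^x 3^{-d(j-1)}`. -/
def phiFun (d : ℕ) (a : ℝ → ℕ → ℕ) (x : ℝ) : ℝ := ∑' j : ℕ, (2 * a x j : ℝ) / 3 ^ (d * j)

/-- `Φ(x_1,…,x_d) = ∑_{p=1}^d 3^{-p} φ(x_p)`. -/
def PhiFun (d : ℕ) (a : ℝ → ℕ → ℕ) (x : Fin d → ℝ) : ℝ :=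
  ∑ p : Fin d, phiFun d a (x p) / 3 ^ ((p : ℕ) + 1)

/-- The truncated interior function `φ_K(x) = ∑_{j=1}^K 2 a_j^x 3^{-d(j-1)}`. -/
def phiTrunc (d K : ℕ) (a : ℝ → ℕ → ℕ) (x : ℝ) : ℝ :=
  ∑ j ∈ Finset.range K, (2 * a x j : ℝ) / 3 ^ (d * j)

/-- An affine layer `y ↦ Ay + b`. -/
def affineMap (m n : ℕ) (A : Fin m → Fin n → ℝ) (b : Fin m → ℝ) (y : Fin n → ℝ) : Fin m → ℝ :=
  fun i => (∑ j, A i j * y j) + b i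

/-- Coordinatewise ReLU. -/
def reluVec {n : ℕ} (y : Fin n → ℝ) : Fin n → ℝ := fun i => max (y i) 0

/-- `RealizedBy ws n F`: the real-valued function `F` on `Fin n → ℝ` is realized by a deep
ReLU network with hidden-layer widths given by the list `ws` (affine output layer). -/
def RealizedBy : List ℕ → (n : ℕ) → ((Fin n → ℝ) → ℝ) → Prop
  | [], n, F => ∃ (A : Fin n → ℝ) (b : ℝ), ∀ y, F y = (∑ j, A j * y j) + b
  | w :: rest, n, F => ∃ (A : Fin w → Fin n → ℝ) (b : Fin w → ℝ) (G : (Fin w → ℝ) → ℝ),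
      RealizedBy rest w G ∧ ∀ y, F y = G (reluVec (affineMap w n A b y))

/-! ### Digit sequences -/

/-- code of a family of binary digit sequences -/
def codeD (d : ℕ) (b : Fin d → ℕ → ℕ) : ℝ :=
  ∑ q : Fin d, (∑' j : ℕ, (2 * b q j : ℝ) / 3 ^ (d * j)) / 3 ^ ((q : ℕ) + 1)

/-- decoding -/
def binVal (s : ℕ → ℕ) : ℝ := ∑' j : ℕ, (s j : ℝ) / 2 ^ (j + 1)

def ternDig (d : ℕ) [NeZero d] (b : Fin d → ℕ → ℕ) (n : ℕ) : Fin 3 :=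
  if b (Nat.divModEquiv d n).2 (Nat.divModEquiv d n).1 = 0 then 0 else 2

lemma ternDig_ne_one (d : ℕ) [NeZero d] (b : Fin d → ℕ → ℕ) (n : ℕ) : ternDig d b n ≠ 1 := by
  unfold ternDig; split_ifs <;> decide

lemma codeD_eq (d : ℕ) [NeZero d] (b : Fin d → ℕ → ℕ) (hb : ∀ q j, b q j ≤ 1) :
    codeD d b = Real.ofDigits (ternDig d b) := by
  have hs : Summable (Real.ofDigitsTerm (ternDig d b)) := Real.summable_ofDigitsTerm
  have hs' : Summable (fun x : ℕ × Fin d =>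
      Real.ofDigitsTerm (ternDig d b) ((Nat.divModEquiv d).symm x)) :=
    (Equiv.summable_iff (Nat.divModEquiv d).symm).2 hs
  have key : ∀ (j : ℕ) (q : Fin d),
      Real.ofDigitsTerm (ternDig d b) ((Nat.divModEquiv d).symm (j, q))
        = (2 * b q j : ℝ) / 3 ^ (d * j) / 3 ^ ((q : ℕ) + 1) := by
    intro j q
    have hn : (Nat.divModEquiv d).symm (j, q) = d * j + q := by
      simp [Nat.divModEquiv, mul_comm]
    unfold Real.ofDigitsTerm ternDig
    rw [Equiv.apply_symm_apply, hn]
    have h1 := hb q j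
    rw [div_div, ← pow_add, div_eq_mul_inv, ← add_assoc]
    push_cast
    congr 1
    interval_cases h : b q j <;> simp
  unfold Real.ofDigits
  rw [← Equiv.tsum_eq (Nat.divModEquiv d).symm, hs'.tsum_prod]
  simp_rw [tsum_fintype, key]
  rw [Summable.tsum_finsetSum]
  · unfold codeD
    refine Finset.sum_congr rfl fun q _ => ?_
    rw [tsum_div_const]
  · intro q _
    have := hs'.prod_factor
    have h2 : Summable ((fun x : ℕ × Fin d =>
      Real.ofDigitsTerm (ternDig d b) ((Nat.divModEquiv d).symm x)) ∘ (fun j : ℕ => (j, q))) :=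
      hs'.comp_injective (fun i j h => by simpa using h)
    refine h2.congr fun j => ?_
    exact key j q

lemma codeD_inj (d : ℕ) [NeZero d] (b b' : Fin d → ℕ → ℕ) (hb : ∀ q j, b q j ≤ 1)
    (hb' : ∀ q j, b' q j ≤ 1) (h : codeD d b = codeD d b') : b = b' := by
  rw [codeD_eq d b hb, codeD_eq d b' hb'] at h
  have := ofDigits_zero_two_sequence_unique (ternDig_ne_one d b) (ternDig_ne_one d b') h
  funext q j
  have h1 := congrFun this ((Nat.divModEquiv d).symm (j, q))
  unfold ternDig at h1
  rw [Equiv.apply_symm_apply] at h1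
  have h2 := hb q j
  have h3 := hb' q j
  simp only at h1
  split_ifs at h1 with h4 h5 h5
  · rw [h4, h5]
  · exact absurd h1 (by decide)
  · exact absurd h1 (by decide)
  · omega

lemma summable_bin (s : ℕ → ℕ) (hs : ∀ j, s j ≤ 1) :
    Summable (fun j : ℕ => (s j : ℝ) / 2 ^ (j + 1)) := by
  have h : Summable (fun j : ℕ => (1 / 2 : ℝ) ^ (j + 1)) :=
    (summable_nat_add_iff 1).2 summable_geometric_two
  refine Summable.of_nonneg_of_le (fun j => by positivity) (fun j => ?_) h
  have : (s j : ℝ) ≤ 1 := by exact_mod_cast hs j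
  rw [one_div, inv_pow, div_eq_mul_inv]
  exact mul_le_of_le_one_left (by positivity) this

lemma binVal_mem (s : ℕ → ℕ) (hs : ∀ j, s j ≤ 1) : binVal s ∈ Icc (0 : ℝ) 1 := by
  constructor
  · exact tsum_nonneg fun j => by positivity
  · have h : HasSum (fun j : ℕ => (1 : ℝ) / 2 / 2 ^ j) 1 := hasSum_geometric_two' 1
    rw [← h.tsum_eq]
    refine Summable.tsum_le_tsum (fun j => ?_) (summable_bin s hs) h.summable
    have : (s j : ℝ) ≤ 1 := by exact_mod_cast hs j
    rw [div_div, pow_succ, mul_comm]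
    gcongr

lemma binVal_succ (s : ℕ → ℕ) (hs : ∀ j, s j ≤ 1) :
    binVal s = (s 0 : ℝ) / 2 + binVal (fun j => s (j + 1)) / 2 := by
  unfold binVal
  rw [(summable_bin s hs).tsum_eq_zero_add, ← tsum_div_const]
  simp only [zero_add, pow_one]
  congr 1
  refine tsum_congr fun j => ?_
  rw [div_div, ← pow_succ]

/-- tail value -/
def tailVal (s : ℕ → ℕ) (j : ℕ) : ℝ := binVal (fun i => s (j + i))

lemma tailVal_mem (s : ℕ → ℕ) (hs : ∀ j, s j ≤ 1) (j : ℕ) : tailVal s j ∈ Icc (0 : ℝ) 1 :=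
  binVal_mem _ fun _ => hs _

lemma tailVal_zero (s : ℕ → ℕ) : tailVal s 0 = binVal s := by
  unfold tailVal; simp

lemma tailVal_succ (s : ℕ → ℕ) (hs : ∀ j, s j ≤ 1) (j : ℕ) :
    tailVal s (j + 1) = 2 * tailVal s j - s j := by
  have := binVal_succ (fun i => s (j + i)) fun _ => hs _
  have h2 : tailVal s (j + 1) = binVal (fun i => s (j + (i + 1))) := by
    unfold tailVal; congr 1; funext i; congr 1; omega
  rw [h2]
  unfold tailVal
  rw [this]
  simp only [add_zero]; ring

lemma tailVal_int (s : ℕ → ℕ) (hs : ∀ j, s j ≤ 1) (j : ℕ) :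
    ∃ m : ℕ, m < 2 ^ j ∧ binVal s * 2 ^ j = m + tailVal s j := by
  induction j with
  | zero => exact ⟨0, by simp, by simp [tailVal_zero]⟩
  | succ j ih =>
    obtain ⟨m, hm, h⟩ := ih
    refine ⟨2 * m + s j, ?_, ?_⟩
    · have := hs j
      rw [pow_succ]; omega
    · rw [tailVal_succ s hs, pow_succ, ← mul_assoc, h]
      push_cast; ring

/-- truncation -/
def truncD (K : ℕ) (s : ℕ → ℕ) (j : ℕ) : ℕ := if j < K then s j else 0

lemma truncD_le (K : ℕ) (s : ℕ → ℕ) (hs : ∀ j, s j ≤ 1) (j : ℕ) : truncD K s j ≤ 1 := by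
  unfold truncD; split_ifs
  · exact hs j
  · omega

lemma binVal_trunc (K : ℕ) (s : ℕ → ℕ) (hs : ∀ j, s j ≤ 1) :
    |binVal s - binVal (truncD K s)| ≤ (1 / 2 : ℝ) ^ K := by
  have h1 : binVal (truncD K s) = ∑ j ∈ Finset.range K, (s j : ℝ) / 2 ^ (j + 1) := by
    unfold binVal
    rw [tsum_eq_sum (s := Finset.range K)]
    · refine Finset.sum_congr rfl fun j hj => ?_
      rw [truncD, if_pos (Finset.mem_range.1 hj)]
    · intro j hj
      rw [truncD, if_neg (by simpa using hj)]; simp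
  have h2 : ∀ J : ℕ, binVal s = ∑ j ∈ Finset.range J, (s j : ℝ) / 2 ^ (j + 1)
      + tailVal s J * (1 / 2) ^ J := by
    intro J
    induction J with
    | zero => simp [tailVal_zero]
    | succ J ih =>
      rw [ih, Finset.sum_range_succ, tailVal_succ s hs, pow_succ, pow_succ, one_div, inv_pow]
      field_simp
      ring
  rw [h1, h2 K, add_sub_cancel_left]
  have := tailVal_mem s hs K
  rw [abs_of_nonneg (mul_nonneg this.1 (by positivity))]
  exact mul_le_of_le_one_left (by positivity) this.2

lemma phi_trunc_eq (d K : ℕ) (s : ℕ → ℕ) :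
    ∑ j ∈ Finset.range K, (2 * s j : ℝ) / 3 ^ (d * j)
      = ∑' j : ℕ, (2 * truncD K s j : ℝ) / 3 ^ (d * j) := by
  rw [tsum_eq_sum (s := Finset.range K)]
  · refine Finset.sum_congr rfl fun j hj => ?_
    rw [truncD, if_pos (Finset.mem_range.1 hj)]
  · intro j hj
    rw [truncD, if_neg (by simpa using hj)]; simp

/-- On the good set the current digit is read off from the tail. -/
lemma digit_gap (K : ℕ) (s : ℕ → ℕ) (hs : ∀ j, s j ≤ 1) (δ : ℝ)
    (hgood : ∀ k : ℕ, k < 2 ^ K → δ ≤ |binVal s - (k : ℝ) / 2 ^ K|) (j : ℕ) (hj : j < K) :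
    (s j = 0 ∧ tailVal s j ≤ 1 / 2 - δ) ∨ (s j = 1 ∧ 1 / 2 + δ ≤ tailVal s j) := by
  obtain ⟨m, hm, h⟩ := tailVal_int s hs j
  have hk : (2 * m + 1) * 2 ^ (K - j - 1) < 2 ^ K := by
    have : 2 ^ K = 2 ^ j * 2 * 2 ^ (K - j - 1) := by
      rw [← pow_succ, ← pow_add]; congr 1; omega
    rw [this]
    exact Nat.mul_lt_mul_of_pos_right (by omega) (by positivity)
  have h3 := hgood _ hk
  have e : (binVal s - ((((2 * m + 1) * 2 ^ (K - j - 1) : ℕ)) : ℝ) / 2 ^ K) * 2 ^ j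
      = tailVal s j - 1 / 2 := by
    have : (2 : ℝ) ^ K = 2 ^ j * 2 * 2 ^ (K - j - 1) := by
      rw [← pow_succ, ← pow_add]; congr 1; omega
    rw [sub_mul, h, this]
    push_cast
    field_simp
    ring
  have h4 : δ ≤ |tailVal s j - 1 / 2| := by
    rw [← e, abs_mul, abs_of_pos (show (0 : ℝ) < 2 ^ j by positivity)]
    refine h3.trans (le_mul_of_one_le_right (abs_nonneg _) (one_le_pow₀ (by norm_num)))
  have h5 := tailVal_succ s hs j
  have h6 := tailVal_mem s hs (j + 1)
  rw [h5] at h6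
  have h7 := hs j
  rcases Nat.le_one_iff_eq_zero_or_eq_one.1 h7 with h8 | h8
  · left
    refine ⟨h8, ?_⟩
    rw [h8] at h6
    have := h6.2
    push_cast at this
    rw [abs_of_nonpos (by linarith)] at h4
    linarith
  · right
    refine ⟨h8, ?_⟩
    rw [h8] at h6
    have := h6.1
    push_cast at this
    rw [abs_of_nonneg (by linarith)] at h4
    linarith

/-! ### One-dimensional interpolation -/

/-- one hidden layer univariate ReLU functions -/
def OneLayer (n : ℕ) (P : ℝ → ℝ) : Prop :=
  ∃ (c : ℝ) (w k : Fin n → ℝ), ∀ t, P t = (∑ i, w i * max (t - k i) 0) + c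

lemma OneLayer.succ {n : ℕ} {P : ℝ → ℝ} (h : OneLayer n P) : OneLayer (n + 1) P := by
  obtain ⟨c, w, k, h⟩ := h
  refine ⟨c, Fin.cons 0 w, Fin.cons 0 k, fun t => ?_⟩
  rw [Fin.sum_univ_succ, h]
  simp

lemma OneLayer.mono {n m : ℕ} {P : ℝ → ℝ} (h : OneLayer n P) (hnm : n ≤ m) : OneLayer m P := by
  induction m, hnm using Nat.le_induction with
  | base => exact h
  | succ m _ ih => exact ih.succ

lemma interp_aux (g : ℝ → ℝ) (B : ℝ) (hB : 0 ≤ B) (s : Finset ℝ) (hg : ∀ c ∈ s, |g c| ≤ B) :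
    ∃ (b : ℝ) (w : ℝ → ℝ) (P : ℝ → ℝ), (∀ t, P t = (∑ c ∈ s, w c * max (t - c) 0) + b) ∧
      (∀ c ∈ s, P c = g c) ∧ (∀ t, |P t| ≤ B) ∧
      (s = ∅ ∨ ∃ c ∈ s, (∀ x ∈ s, x ≤ c) ∧ ∀ t, c ≤ t → P t = g c) := by
  induction s using Finset.induction_on_max with
  | empty => exact ⟨0, fun _ => 0, fun _ => 0, by simp, by simp, by simpa using hB, Or.inl rfl⟩
  | insert m s hm ih =>
    obtain ⟨b, w, P, hP, hPg, hPB, hlast⟩ := ih fun c hc => hg c (Finset.mem_insert_of_mem hc)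
    have hms : m ∉ s := fun h => lt_irrefl _ (hm m h)
    have hgm := hg m (Finset.mem_insert_self _ _)
    rcases hlast with rfl | ⟨c, hc, hcmax, hcP⟩
    · refine ⟨g m, fun _ => 0, fun _ => g m, by simp, by simp, fun _ => hgm, Or.inr ?_⟩
      exact ⟨m, by simp, by simp, fun _ _ => rfl⟩
    · have hcm : c < m := hm c hc
      have hgc := hg c (Finset.mem_insert_of_mem hc)
      set v := (g m - g c) / (m - c) with hv
      have hmc : 0 < m - c := sub_pos.2 hcm
      have hvm : v * (m - c) = g m - g c := by rw [hv]; field_simp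
      have hlow : ∀ t, t ≤ c → P t + v * (max (t - c) 0 - max (t - m) 0) = P t := by
        intro t ht
        rw [max_eq_right (by linarith), max_eq_right (by linarith)]; ring
      have hhigh : ∀ t, m ≤ t → P t + v * (max (t - c) 0 - max (t - m) 0) = g m := by
        intro t ht
        rw [max_eq_left (by linarith), max_eq_left (by linarith), hcP t (by linarith)]
        have : v * (t - c - (t - m)) = v * (m - c) := by ring
        rw [this, hvm]; ring
      refine ⟨b, fun x => if x = m then -v else if x = c then w c + v else w x,
        fun t => P t + v * (max (t - c) 0 - max (t - m) 0), ?_, ?_, ?_, Or.inr ?_⟩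
      · intro t
        beta_reduce
        rw [Finset.sum_insert hms, hP, ← Finset.add_sum_erase s _ hc,
          ← Finset.add_sum_erase s _ hc]
        simp only [if_true, if_neg hcm.ne]
        have : ∑ x ∈ s.erase c, (if x = m then -v else if x = c then w c + v else w x)
            * max (t - x) 0 = ∑ x ∈ s.erase c, w x * max (t - x) 0 := by
          refine Finset.sum_congr rfl fun x hx => ?_
          have hx' := Finset.mem_erase.1 hx
          rw [if_neg (hm x hx'.2).ne, if_neg hx'.1]
        rw [this]
        ring
      · intro x hx
        rcases Finset.mem_insert.1 hx with rfl | hx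
        · exact hhigh _ le_rfl
        · show P x + _ = _
          rw [hlow x (hcmax x hx), hPg x hx]
      · intro t
        show |P t + v * (max (t - c) 0 - max (t - m) 0)| ≤ B
        rcases le_total t c with h1 | h1
        · rw [hlow t h1]; exact hPB t
        · rcases le_total m t with h2 | h2
          · rw [hhigh t h2]; exact hgm
          · rw [max_eq_left (by linarith), max_eq_right (by linarith), hcP t h1, sub_zero]
            have e : (g c + v * (t - c)) * (m - c) = g c * (m - t) + g m * (t - c) := by
              have : (g c + v * (t - c)) * (m - c) = g c * (m - c) + v * (m - c) * (t - c) := by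
                ring
              rw [this, hvm]; ring
            rw [abs_le] at hgm hgc ⊢
            constructor
            · refine le_of_mul_le_mul_right ?_ hmc
              rw [e]
              nlinarith [mul_le_mul_of_nonneg_right hgc.1 (sub_nonneg.2 h2),
                mul_le_mul_of_nonneg_right hgm.1 (sub_nonneg.2 h1)]
            · refine le_of_mul_le_mul_right ?_ hmc
              rw [e]
              nlinarith [mul_le_mul_of_nonneg_right hgc.2 (sub_nonneg.2 h2),
                mul_le_mul_of_nonneg_right hgm.2 (sub_nonneg.2 h1)]
      · refine ⟨m, Finset.mem_insert_self _ _, fun x hx => ?_, fun t ht => hhigh t ht⟩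
        rcases Finset.mem_insert.1 hx with rfl | hx
        · exact le_rfl
        · exact (hm x hx).le

lemma interp (g : ℝ → ℝ) (B : ℝ) (hB : 0 ≤ B) (s : Finset ℝ) (hg : ∀ c ∈ s, |g c| ≤ B)
    (n : ℕ) (hn : s.card ≤ n) :
    ∃ P : ℝ → ℝ, OneLayer n P ∧ (∀ c ∈ s, P c = g c) ∧ (∀ t, |P t| ≤ B) := by
  obtain ⟨b, w, P, hP, hPg, hPB, -⟩ := interp_aux g B hB s hg
  refine ⟨P, OneLayer.mono ⟨b, fun i => w (s.equivFin.symm i), fun i => s.equivFin.symm i,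
    fun t => ?_⟩ hn, hPg, hPB⟩
  rw [hP, ← Finset.sum_coe_sort s, ← Equiv.sum_comp s.equivFin.symm]

/-! ### Networks -/

/-- affine functionals -/
def IsAff (n : ℕ) (L : (Fin n → ℝ) → ℝ) : Prop :=
  ∃ (A : Fin n → ℝ) (b : ℝ), ∀ y, L y = (∑ j, A j * y j) + b

lemma IsAff.const (n : ℕ) (c : ℝ) : IsAff n (fun _ => c) := ⟨0, c, by simp⟩

lemma IsAff.coord {n : ℕ} (i : Fin n) : IsAff n (fun y => y i) := by
  refine ⟨Pi.single i 1, 0, fun y => ?_⟩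
  simp [Pi.single_apply]

lemma IsAff.add {n : ℕ} {L M : (Fin n → ℝ) → ℝ} (hL : IsAff n L) (hM : IsAff n M) :
    IsAff n (fun y => L y + M y) := by
  obtain ⟨A, b, h⟩ := hL
  obtain ⟨A', b', h'⟩ := hM
  refine ⟨A + A', b + b', fun y => ?_⟩
  beta_reduce
  rw [h, h']
  simp only [Pi.add_apply, add_mul, Finset.sum_add_distrib]
  ring

lemma IsAff.smul {n : ℕ} {L : (Fin n → ℝ) → ℝ} (c : ℝ) (hL : IsAff n L) :
    IsAff n (fun y => c * L y) := by
  obtain ⟨A, b, h⟩ := hL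
  refine ⟨fun j => c * A j, c * b, fun y => ?_⟩
  beta_reduce
  rw [h, mul_add, Finset.mul_sum]
  simp only [mul_assoc]

lemma IsAff.sub {n : ℕ} {L M : (Fin n → ℝ) → ℝ} (hL : IsAff n L) (hM : IsAff n M) :
    IsAff n (fun y => L y - M y) := by
  have := hL.add (hM.smul (-1))
  simpa [sub_eq_add_neg] using this

lemma realizedBy_cons {w n : ℕ} {rest : List ℕ} {G : (Fin w → ℝ) → ℝ} (hG : RealizedBy rest w G)
    (L : Fin w → (Fin n → ℝ) → ℝ) (hL : ∀ i, IsAff n (L i)) :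
    RealizedBy (w :: rest) n (fun y => G (fun i => max (L i y) 0)) := by
  choose A b h using hL
  refine ⟨A, b, G, hG, fun y => ?_⟩
  beta_reduce
  congr 1
  funext i
  simp [reluVec, affineMap, h]

lemma realizedBy_final {N : ℕ} {P : ℝ → ℝ} (hP : OneLayer N P) :
    RealizedBy [N] 1 (fun y => P (y 0)) := by
  obtain ⟨c, w, k, h⟩ := hP
  have hG : RealizedBy [] N (fun y => (∑ j, w j * y j) + c) := ⟨w, c, fun _ => rfl⟩
  have := realizedBy_cons (n := 1) hG (fun i y => y 0 - k i)
    fun i => (IsAff.coord 0).sub (IsAff.const _ _)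
  simpa [h] using this

/-- the layer encoding: neurons from residual `r`, accumulator `s` -/
def enc (M : ℝ) (i : Fin 4) (r s : ℝ) : ℝ :=
  match i with
  | 0 => r
  | 1 => s
  | 2 => M * (r - 1 / 2) + 1 / 2
  | 3 => M * (r - 1 / 2) - 1 / 2

lemma IsAff.enc {n : ℕ} {r s : (Fin n → ℝ) → ℝ} (hr : IsAff n r) (hs : IsAff n s) (M : ℝ)
    (i : Fin 4) : IsAff n (fun y => enc M i (r y) (s y)) := by
  have h := (hr.sub (IsAff.const n (1 / 2))).smul M
  fin_cases i
  · exact hr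
  · exact hs
  · exact h.add (IsAff.const n (1 / 2))
  · exact h.sub (IsAff.const n (1 / 2))

/-- neuron `i` of coordinate `q` -/
def nrn (d : ℕ) (i : Fin 4) (q : Fin d) : Fin (4 * d) := finProdFinEquiv (i, q)

def readBit {d : ℕ} (v : Fin (4 * d) → ℝ) (q : Fin d) : ℝ := v (nrn d 2 q) - v (nrn d 3 q)

def newR {d : ℕ} (v : Fin (4 * d) → ℝ) (q : Fin d) : ℝ := 2 * v (nrn d 0 q) - readBit v q

def newS {d : ℕ} (c : ℝ) (v : Fin (4 * d) → ℝ) (q : Fin d) : ℝ :=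
  v (nrn d 1 q) + c * readBit v q

lemma isAff_readBit {d : ℕ} (q : Fin d) : IsAff (4 * d) (fun v => readBit v q) :=
  (IsAff.coord _).sub (IsAff.coord _)

lemma isAff_newR {d : ℕ} (q : Fin d) : IsAff (4 * d) (fun v => newR v q) :=
  ((IsAff.coord _).smul 2).sub (isAff_readBit q)

lemma isAff_newS {d : ℕ} (c : ℝ) (q : Fin d) : IsAff (4 * d) (fun v => newS c v q) :=
  (IsAff.coord _).add ((isAff_readBit q).smul c)

/-- the ReLU layer with residuals `r` and accumulators `s` -/
def layer (d : ℕ) (M : ℝ) (r s : Fin d → ℝ) : Fin (4 * d) → ℝ := fun i =>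
  max (enc M (finProdFinEquiv.symm i).1 (r (finProdFinEquiv.symm i).2)
    (s (finProdFinEquiv.symm i).2)) 0

lemma layer_nrn (d : ℕ) (M : ℝ) (r s : Fin d → ℝ) (i : Fin 4) (q : Fin d) :
    layer d M r s (nrn d i q) = max (enc M i (r q) (s q)) 0 := by
  simp [layer, nrn]

/-- digit weights -/
def cw (d K j : ℕ) : ℝ := if j < K then 2 / 3 ^ (d * j) else 0

/-- invariant before the `j`-th digit has been added -/
def NInv (d K : ℕ) (b : Fin d → ℕ → ℕ) (j : ℕ) (v : Fin (4 * d) → ℝ) : Prop :=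
  ∀ q, v (nrn d 1 q) = ∑ i ∈ Finset.range j, cw d K i * b q i ∧
    (j < K → v (nrn d 0 q) = tailVal (b q) j ∧ readBit v q = b q j)

/-- goodness of a family of digits -/
def Good (d K : ℕ) (δ : ℝ) (b : Fin d → ℕ → ℕ) : Prop :=
  (∀ q j, b q j ≤ 1) ∧ ∀ q, ∀ k : ℕ, k < 2 ^ K → δ ≤ |binVal (b q) - (k : ℝ) / 2 ^ K|

lemma cw_nonneg (d K j : ℕ) : 0 ≤ cw d K j := by
  unfold cw; split_ifs <;> positivity

lemma Inv_layer (d K : ℕ) (δ : ℝ) (hδ : 0 < δ) (b : Fin d → ℕ → ℕ) (hb : Good d K δ b) (j : ℕ)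
    (r s : Fin d → ℝ) (hs : ∀ q, s q = ∑ i ∈ Finset.range j, cw d K i * b q i)
    (hr : j < K → ∀ q, r q = tailVal (b q) j) : NInv d K b j (layer d (1 / (2 * δ)) r s) := by
  intro q
  have hMδ : 1 / (2 * δ) * δ = 1 / 2 := by field_simp
  have hM : 0 < 1 / (2 * δ) := by positivity
  refine ⟨?_, fun hj => ⟨?_, ?_⟩⟩
  · rw [layer_nrn]
    show max (s q) 0 = _
    rw [hs, max_eq_left]
    exact Finset.sum_nonneg fun i _ => mul_nonneg (cw_nonneg _ _ _) (by positivity)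
  · rw [layer_nrn]
    show max (r q) 0 = _
    rw [hr hj, max_eq_left (tailVal_mem _ (hb.1 q) j).1]
  · unfold readBit
    rw [layer_nrn, layer_nrn]
    show max (1 / (2 * δ) * (r q - 1 / 2) + 1 / 2) 0
      - max (1 / (2 * δ) * (r q - 1 / 2) - 1 / 2) 0 = _
    rw [hr hj]
    rcases digit_gap K (b q) (hb.1 q) δ (hb.2 q) j hj with ⟨h0, h⟩ | ⟨h1, h⟩
    · have : 1 / (2 * δ) * (tailVal (b q) j - 1 / 2) ≤ 1 / (2 * δ) * (-δ) :=
        mul_le_mul_of_nonneg_left (by linarith) hM.le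
      rw [h0, max_eq_right (by linarith), max_eq_right (by linarith)]; simp
    · have : 1 / (2 * δ) * δ ≤ 1 / (2 * δ) * (tailVal (b q) j - 1 / 2) :=
        mul_le_mul_of_nonneg_left (by linarith) hM.le
      rw [h1, max_eq_left (by linarith), max_eq_left (by linarith)]; push_cast; ring

lemma newS_of_Inv {d K : ℕ} {b : Fin d → ℕ → ℕ} {j : ℕ} {v : Fin (4 * d) → ℝ}
    (h : NInv d K b j v) (q : Fin d) :
    newS (cw d K j) v q = ∑ i ∈ Finset.range (j + 1), cw d K i * b q i := by
  unfold newS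
  rw [Finset.sum_range_succ, (h q).1]
  by_cases hj : j < K
  · rw [((h q).2 hj).2]
  · simp [cw, hj]

lemma sum_cw (d K : ℕ) (s : ℕ → ℕ) (n : ℕ) (hn : K ≤ n) :
    ∑ i ∈ Finset.range n, cw d K i * s i
      = ∑ j ∈ Finset.range K, (2 * s j : ℝ) / 3 ^ (d * j) := by
  symm
  have h1 : ∑ j ∈ Finset.range K, (2 * s j : ℝ) / 3 ^ (d * j)
      = ∑ i ∈ Finset.range K, cw d K i * s i := by
    refine Finset.sum_congr rfl fun i hi => ?_
    rw [cw, if_pos (Finset.mem_range.1 hi)]; ring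
  rw [h1]
  refine Finset.sum_subset (by simpa using hn) fun i _ hi => ?_
  rw [cw, if_neg (by simpa using hi)]; simp

/-- truncated value -/
def tv (d K : ℕ) (b : Fin d → ℕ → ℕ) : ℝ :=
  ∑ q : Fin d, (∑ j ∈ Finset.range K, (2 * b q j : ℝ) / 3 ^ (d * j)) / 3 ^ ((q : ℕ) + 1)

lemma IsAff.wsum {d : ℕ} (w : Fin d → ℝ) : IsAff d (fun y => ∑ q, y q / w q) := by
  refine ⟨fun q => 1 / w q, 0, fun y => ?_⟩
  rw [add_zero]
  exact Finset.sum_congr rfl fun q _ => by ring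

lemma net_aux (d K N : ℕ) (δ : ℝ) (hδ : 0 < δ) (P : ℝ → ℝ) (B : ℝ) (hP : OneLayer N P)
    (hB : ∀ t, |P t| ≤ B) (m : ℕ) : ∀ j, K ≤ j + m + 1 →
    ∃ H : (Fin (4 * d) → ℝ) → ℝ, RealizedBy (List.replicate m (4 * d) ++ [d, 1, N]) (4 * d) H ∧
      (∀ v, |H v| ≤ B) ∧ ∀ b, Good d K δ b → ∀ v, NInv d K b j v → H v = P (tv d K b) := by
  induction m with
  | zero =>
    intro j hj
    have h1 := realizedBy_cons (n := d) (realizedBy_final hP)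
      (fun _ y => ∑ q, y q / 3 ^ ((q : ℕ) + 1)) (fun _ => IsAff.wsum _)
    have h2 := realizedBy_cons (n := 4 * d) h1 (fun q v => newS (cw d K j) v q)
      (fun q => isAff_newS _ q)
    refine ⟨_, h2, fun v => hB _, fun b hb v hv => ?_⟩
    have h3 : ∀ q, max (newS (cw d K j) v q) 0
        = ∑ j ∈ Finset.range K, (2 * b q j : ℝ) / 3 ^ (d * j) := by
      intro q
      rw [newS_of_Inv hv, sum_cw d K (b q) (j + 1) (by omega), max_eq_left]
      exact Finset.sum_nonneg fun i _ => by positivity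
    simp only [h3]
    rw [max_eq_left]
    · rfl
    · exact Finset.sum_nonneg fun q _ => div_nonneg
        (Finset.sum_nonneg fun i _ => by positivity) (by positivity)
  | succ m ih =>
    intro j hj
    obtain ⟨H, hH, hHB, hHI⟩ := ih (j + 1) (by omega)
    have h := realizedBy_cons (n := 4 * d) hH
      (fun i v => enc (1 / (2 * δ)) (finProdFinEquiv.symm i).1
        (newR v (finProdFinEquiv.symm i).2) (newS (cw d K j) v (finProdFinEquiv.symm i).2))
      (fun i => IsAff.enc (isAff_newR _) (isAff_newS _ _) _ _)
    refine ⟨fun v => H (layer d (1 / (2 * δ)) (newR v) (newS (cw d K j) v)), ?_,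
      fun v => hHB _, fun b hb v hv => ?_⟩
    · rw [List.replicate_succ, List.cons_append]
      exact h
    · refine hHI b hb _ (Inv_layer d K δ hδ b hb (j + 1) _ _ (fun q => newS_of_Inv hv q) ?_)
      intro hj' q
      have h4 := (hv q).2 (by omega)
      unfold newR
      rw [h4.1, h4.2, tailVal_succ _ (hb.1 q)]

lemma net (d K N : ℕ) (hK : 1 ≤ K) (δ : ℝ) (hδ : 0 < δ) (P : ℝ → ℝ) (B : ℝ) (hP : OneLayer N P)
    (hB : ∀ t, |P t| ≤ B) :
    ∃ H : (Fin d → ℝ) → ℝ, RealizedBy (List.replicate (2 * K) (4 * d) ++ [d, 1, N]) d H ∧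
      (∀ x, |H x| ≤ B) ∧
      ∀ b, Good d K δ b → H (fun q => binVal (b q)) = P (tv d K b) := by
  obtain ⟨H, hH, hHB, hHI⟩ := net_aux d K N δ hδ P B hP hB (2 * K - 1) 0 (by omega)
  have h := realizedBy_cons (n := d) hH
      (fun i x => enc (1 / (2 * δ)) (finProdFinEquiv.symm i).1
        (x (finProdFinEquiv.symm i).2) 0)
      (fun i => IsAff.enc (IsAff.coord _) (IsAff.const _ _) _ _)
  refine ⟨fun x => H (layer d (1 / (2 * δ)) x (fun _ => 0)), ?_, fun x => hHB _, fun b hb => ?_⟩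
  · have e : 2 * K = (2 * K - 1) + 1 := by omega
    rw [e, List.replicate_succ, List.cons_append]
    exact h
  · refine hHI b hb _ (Inv_layer d K δ hδ b hb 0 _ (fun _ => 0) (fun q => by simp) ?_)
    intro _ q
    rw [tailVal_zero]

/-! ### Measure estimates -/

/-- boxes of the exceptional set -/
def badBox (d K : ℕ) (δ : ℝ) (q : Fin d) (k : ℕ) : Set (Fin d → ℝ) :=
  Set.pi univ (Function.update (fun _ : Fin d => Icc (0 : ℝ) 1) q
    (Ioo ((k : ℝ) / 2 ^ K - δ) ((k : ℝ) / 2 ^ K + δ)))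

lemma volume_badBox (d K : ℕ) (δ : ℝ) (q : Fin d) (k : ℕ) :
    volume (badBox d K δ q k) = ENNReal.ofReal (2 * δ) := by
  unfold badBox
  rw [volume_pi_pi, Finset.prod_eq_single q]
  · rw [Function.update_self, Real.volume_Ioo]; congr 1; ring
  · intro i _ hi
    rw [Function.update_of_ne hi, Real.volume_Icc]; simp
  · simp

lemma measurableSet_badBox (d K : ℕ) (δ : ℝ) (q : Fin d) (k : ℕ) :
    MeasurableSet (badBox d K δ q k) := by
  refine MeasurableSet.univ_pi fun i => ?_
  by_cases h : i = q
  · subst h; rw [Function.update_self]; exact measurableSet_Ioo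
  · rw [Function.update_of_ne h]; exact measurableSet_Icc

def badSet (d K : ℕ) (δ : ℝ) : Set (Fin d → ℝ) :=
  ⋃ q : Fin d, ⋃ k : Fin (2 ^ K), badBox d K δ q k

lemma measurableSet_badSet (d K : ℕ) (δ : ℝ) : MeasurableSet (badSet d K δ) :=
  MeasurableSet.iUnion fun _ => MeasurableSet.iUnion fun _ => measurableSet_badBox _ _ _ _ _

lemma volume_badSet (d K : ℕ) (δ : ℝ) :
    volume (badSet d K δ) ≤ ENNReal.ofReal (d * 2 ^ K * (2 * δ)) := by
  have h : volume (badSet d K δ) ≤ ∑ q : Fin d, ∑ k : Fin (2 ^ K), ENNReal.ofReal (2 * δ) := by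
    refine (measure_iUnion_fintype_le _ _).trans (Finset.sum_le_sum fun q _ => ?_)
    refine (measure_iUnion_fintype_le _ _).trans (Finset.sum_le_sum fun k _ => ?_)
    rw [volume_badBox]
  refine h.trans (le_of_eq ?_)
  simp only [Finset.sum_const, Finset.card_univ, Fintype.card_fin, nsmul_eq_mul]
  have e : ENNReal.ofReal ((d : ℝ) * 2 ^ K) = (d : ENNReal) * ((2 ^ K : ℕ) : ENNReal) := by
    rw [← ENNReal.ofReal_natCast, ← ENNReal.ofReal_natCast, ← ENNReal.ofReal_mul (by positivity)]
    push_cast; rfl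
  rw [ENNReal.ofReal_mul (p := (d : ℝ) * 2 ^ K) (by positivity), e, mul_assoc]

lemma not_mem_badSet {d K : ℕ} {δ : ℝ} {x : Fin d → ℝ} (hx : x ∈ cube d)
    (h : x ∉ badSet d K δ) (q : Fin d) (k : ℕ) (hk : k < 2 ^ K) : δ ≤ |x q - (k : ℝ) / 2 ^ K| := by
  by_contra hlt
  push Not at hlt
  apply h
  refine mem_iUnion.2 ⟨q, mem_iUnion.2 ⟨⟨k, hk⟩, ?_⟩⟩
  intro i _
  by_cases hi : i = q
  · subst hi
    rw [Function.update_self]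
    rw [abs_lt] at hlt
    constructor <;> simp only <;> linarith [hlt.1, hlt.2]
  · rw [Function.update_of_ne hi]; exact hx i

lemma cube_eq (d : ℕ) : cube d = Set.pi univ (fun _ : Fin d => Icc (0 : ℝ) 1) := by
  ext x; exact ⟨fun h i _ => h i, fun h i => h i (mem_univ i)⟩

lemma volume_cube (d : ℕ) : volume (cube d) = 1 := by
  rw [cube_eq, volume_pi_pi]; simp

lemma measurableSet_cube (d : ℕ) : MeasurableSet (cube d) := by
  rw [cube_eq]; exact MeasurableSet.univ_pi fun i => measurableSet_Icc

lemma lp_bound (d : ℕ) (h : (Fin d → ℝ) → ℝ) (E : Set (Fin d → ℝ)) (hE : MeasurableSet E)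
    (p T A C : ℝ) (hp : 1 ≤ p) (hT : 0 ≤ T) (hA : 0 ≤ A) (hC : 0 ≤ C)
    (hvol : volume E ≤ ENNReal.ofReal (T ^ p))
    (h1 : ∀ x ∈ cube d, |h x| ≤ C) (h2 : ∀ x ∈ cube d, x ∉ E → |h x| ≤ A * T) :
    (∫ x in cube d, |h x| ^ p) ^ (1 / p) ≤ (A + C) * T := by
  have hp0 : 0 < p := by linarith
  have hfin : IsFiniteMeasure (volume.restrict (cube d)) :=
    ⟨by rw [Measure.restrict_apply_univ, volume_cube]; exact ENNReal.one_lt_top⟩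
  have hI : Integrable (fun x => (A * T) ^ p + E.indicator (fun _ => C ^ p) x)
      (volume.restrict (cube d)) :=
    (integrable_const _).add ((integrable_const _).indicator hE)
  have hle : ∫ x in cube d, |h x| ^ p
      ≤ ∫ x in cube d, ((A * T) ^ p + E.indicator (fun _ => C ^ p) x) := by
    refine integral_mono_of_nonneg (Eventually.of_forall fun x => ?_) hI ?_
    · exact Real.rpow_nonneg (abs_nonneg _) _
    · filter_upwards [ae_restrict_mem (measurableSet_cube d)] with x hx
      by_cases hxE : x ∈ E
      · rw [indicator_of_mem hxE]
        have := Real.rpow_le_rpow (abs_nonneg _) (h1 x hx) hp0.le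
        have h0 : 0 ≤ (A * T) ^ p := Real.rpow_nonneg (mul_nonneg hA hT) _
        linarith
      · rw [indicator_of_notMem hxE, add_zero]
        exact Real.rpow_le_rpow (abs_nonneg _) (h2 x hx hxE) hp0.le
  have hval : ∫ x in cube d, ((A * T) ^ p + E.indicator (fun _ => C ^ p) x)
      ≤ (A * T) ^ p + (C * T) ^ p := by
    rw [integral_add (integrable_const _) ((integrable_const _).indicator hE),
      integral_indicator hE, integral_const, setIntegral_const]
    have e1 : (volume.restrict (cube d)).real univ = 1 := by
      simp [Measure.real, volume_cube]
    have e2 : (volume.restrict (cube d)).real E ≤ T ^ p := by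
      unfold Measure.real
      refine ENNReal.toReal_le_of_le_ofReal (Real.rpow_nonneg hT _) ?_
      exact (Measure.restrict_apply_le _ _).trans hvol
    rw [e1, one_smul, smul_eq_mul, Real.mul_rpow hC hT, mul_comm (C ^ p)]
    gcongr
  have h0 : 0 ≤ ∫ x in cube d, |h x| ^ p :=
    integral_nonneg fun x => Real.rpow_nonneg (abs_nonneg _) _
  calc (∫ x in cube d, |h x| ^ p) ^ (1 / p)
      ≤ ((A * T) ^ p + (C * T) ^ p) ^ (1 / p) :=
        Real.rpow_le_rpow h0 (hle.trans hval) (by positivity)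
    _ ≤ A * T + C * T := by
        lift A to NNReal using hA
        lift C to NNReal using hC
        lift T to NNReal using hT
        exact_mod_cast NNReal.rpow_add_rpow_le_add (A * T) (C * T) hp
    _ = _ := by ring

open Classical in
/-- the outer function -/
def outerG (d : ℕ) (f : (Fin d → ℝ) → ℝ) (c : ℝ) : ℝ :=
  if h : ∃ b : Fin d → ℕ → ℕ, (∀ q j, b q j ≤ 1) ∧ codeD d b = c then
    f (fun q => binVal (h.choose q)) else 0

lemma outerG_code (d : ℕ) [NeZero d] (f : (Fin d → ℝ) → ℝ) (b : Fin d → ℕ → ℕ)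
    (hb : ∀ q j, b q j ≤ 1) : outerG d f (codeD d b) = f (fun q => binVal (b q)) := by
  have h : ∃ b' : Fin d → ℕ → ℕ, (∀ q j, b' q j ≤ 1) ∧ codeD d b' = codeD d b := ⟨b, hb, rfl⟩
  unfold outerG
  rw [dif_pos h]
  rw [codeD_inj d h.choose b h.choose_spec.1 hb h.choose_spec.2]

lemma tv_eq (d K : ℕ) (b : Fin d → ℕ → ℕ) : tv d K b = codeD d (fun q => truncD K (b q)) := by
  unfold tv codeD
  simp only [phi_trunc_eq]

/-- knots -/
def knots (d K : ℕ) : Finset ℝ :=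
  Finset.univ.image fun c : Fin d → Fin K → Fin 2 =>
    tv d K (fun q j => if h : j < K then (c q ⟨j, h⟩ : ℕ) else 0)

lemma card_knots (d K : ℕ) : (knots d K).card ≤ 2 ^ (K * d) := by
  refine Finset.card_image_le.trans ?_
  simp [pow_mul]

lemma tv_mem_knots (d K : ℕ) (b : Fin d → ℕ → ℕ) (hb : ∀ q j, b q j ≤ 1) :
    tv d K b ∈ knots d K := by
  refine Finset.mem_image.2 ⟨fun q j => ⟨b q j, by have := hb q j; omega⟩, Finset.mem_univ _, ?_⟩
  unfold tv
  refine Finset.sum_congr rfl fun q _ => ?_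
  congr 1
  refine Finset.sum_congr rfl fun j hj => ?_
  beta_reduce
  rw [dif_pos (Finset.mem_range.1 hj)]

/-- Let `d ≥ 2`, `0 < β ≤ 1`, `Q > 0`, `p ∈ [1,∞)`, `K ≥ 1`. For every
`(Q,β)`-Hölder `f : [0,1]^d → ℝ` there is a deep ReLU network `f̃` with hidden widths
`(4d,…,4d,d,1,2^{Kd}+1)` (i.e. `2K+3` hidden layers) such that
`‖f − f̃‖_{L^p([0,1]^d)} ≤ (16Q + 2‖f‖_∞) 2^{-βK}`; in particular `f̃` agrees with the
truncated KA approximation `g(∑_p 3^{-p} φ_K(x_p))` outside a set of Lebesgue measure at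
most `d·2^{-Kβp}`, and is bounded by `‖f‖_∞` on the cube. -/
theorem stmt19 (d K : ℕ) (hd : 2 ≤ d) (hK : 1 ≤ K) (β Q p : ℝ)
    (hβ0 : 0 < β) (hβ1 : β ≤ 1) (hQ : 0 < Q) (hp : 1 ≤ p)
    (a : ℝ → ℕ → ℕ) (ha : IsBinaryExp a) (f : (Fin d → ℝ) → ℝ)
    (hf : ∀ x ∈ cube d, ∀ y ∈ cube d, |f x - f y| ≤ Q * ‖x - y‖ ^ β) :
    ∃ (ft : (Fin d → ℝ) → ℝ) (g : ℝ → ℝ) (E : Set (Fin d → ℝ)),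
      RealizedBy (List.replicate (2 * K) (4 * d) ++ [d, 1, 2 ^ (K * d) + 1]) d ft ∧
      (∀ x ∈ cube d, f x = g (PhiFun d a x)) ∧
      volume E ≤ ENNReal.ofReal ((d : ℝ) * 2 ^ (-(K : ℝ) * β * p)) ∧
      (∀ x ∈ cube d \ E,
        ft x = g (∑ q : Fin d, phiTrunc d K a (x q) / 3 ^ ((q : ℕ) + 1))) ∧
      (∀ x ∈ cube d, |ft x| ≤ sSup ((fun z => |f z|) '' cube d)) ∧
      (∫ x in cube d, |f x - ft x| ^ p) ^ (1 / p)
        ≤ (16 * Q + 2 * sSup ((fun z => |f z|) '' cube d)) * 2 ^ (-β * (K : ℝ)) := by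
  have : NeZero d := ⟨by omega⟩
  have hd0 : (0 : ℝ) < d := by exact_mod_cast (by omega : 0 < d)
  set B := sSup ((fun z => |f z|) '' cube d) with hBdef
  have h0c : (0 : Fin d → ℝ) ∈ cube d := fun q => by simp
  have hbdd : BddAbove ((fun z => |f z|) '' cube d) := by
    refine ⟨|f 0| + Q, ?_⟩
    rintro _ ⟨x, hx, rfl⟩
    have h1 := hf x hx 0 h0c
    have h2 : ‖x - 0‖ ≤ 1 := by
      rw [sub_zero, pi_norm_le_iff_of_nonneg zero_le_one]
      intro q
      rw [Real.norm_eq_abs, abs_of_nonneg (hx q).1]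
      exact (hx q).2
    have h3 : ‖x - 0‖ ^ β ≤ 1 := Real.rpow_le_one (norm_nonneg _) h2 hβ0.le
    have h4 : Q * ‖x - 0‖ ^ β ≤ Q := mul_le_of_le_one_right hQ.le h3
    have h5 := abs_sub_abs_le_abs_sub (f x) (f 0)
    show |f x| ≤ _
    linarith
  have hfB : ∀ x ∈ cube d, |f x| ≤ B := fun x hx => le_csSup hbdd ⟨x, hx, rfl⟩
  have hB0 : 0 ≤ B := (abs_nonneg _).trans (hfB 0 h0c)
  have hdec : ∀ b : Fin d → ℕ → ℕ, (∀ q j, b q j ≤ 1) → (fun q => binVal (b q)) ∈ cube d :=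
    fun b hb q => binVal_mem _ (hb q)
  have htv : ∀ b : Fin d → ℕ → ℕ, (∀ q j, b q j ≤ 1) →
      outerG d f (tv d K b) = f (fun q => binVal (truncD K (b q))) := by
    intro b hb
    rw [tv_eq]
    exact outerG_code d f _ fun q j => truncD_le K _ (hb q) j
  obtain ⟨P, hP, hPg, hPB⟩ := interp (outerG d f) B hB0 (knots d K) (by
    intro c hc
    obtain ⟨e, -, rfl⟩ := Finset.mem_image.1 hc
    have hb : ∀ (q : Fin d) (j : ℕ), (if h : j < K then (e q ⟨j, h⟩ : ℕ) else 0) ≤ 1 := by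
      intro q j
      split_ifs with h
      · have := (e q ⟨j, h⟩).isLt; omega
      · omega
    rw [htv _ hb]
    exact hfB _ (hdec _ fun q j => truncD_le K _ (hb q) j)) (2 ^ (K * d) + 1)
    ((card_knots d K).trans (Nat.le_succ _))
  set V : ℝ := 2 ^ (-(K : ℝ) * β * p) with hV
  have hV0 : 0 < V := by positivity
  set δ : ℝ := V / (d * 2 ^ K * 2) with hδdef
  have hδ : 0 < δ := by positivity
  obtain ⟨ft, hft, hftB, hftg⟩ := net d K (2 ^ (K * d) + 1) hK δ hδ P B hP hPB
  have hvol : volume (badSet d K δ) ≤ ENNReal.ofReal V := by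
    refine (volume_badSet d K δ).trans (le_of_eq ?_)
    congr 1
    rw [hδdef]; field_simp
  have hxa : ∀ x ∈ cube d, (∀ q j, a (x q) j ≤ 1) ∧ ∀ q, x q = binVal (a (x q)) :=
    fun x hx => ⟨fun q => (ha _ (hx q)).1, fun q => (ha _ (hx q)).2⟩
  have hgood : ∀ x ∈ cube d, x ∉ badSet d K δ →
      ft x = outerG d f (tv d K (fun q => a (x q))) := by
    intro x hx hxE
    have hb : Good d K δ (fun q => a (x q)) := by
      refine ⟨(hxa x hx).1, fun q k hk => ?_⟩
      rw [← (hxa x hx).2 q]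
      exact not_mem_badSet hx hxE q k hk
    have h := hftg _ hb
    have e : (fun q => binVal (a (x q))) = x := funext fun q => ((hxa x hx).2 q).symm
    rw [← hPg _ (tv_mem_knots d K _ hb.1), ← h, e]
  refine ⟨ft, outerG d f, badSet d K δ, hft, ?_, ?_, ?_, fun x _ => hftB x, ?_⟩
  · intro x hx
    have h := outerG_code d f (fun q => a (x q)) (hxa x hx).1
    have e : (fun q => binVal (a (x q))) = x := funext fun q => ((hxa x hx).2 q).symm
    rw [e] at h
    exact h.symm
  · refine hvol.trans (ENNReal.ofReal_le_ofReal ?_)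
    refine le_mul_of_one_le_left hV0.le ?_
    exact_mod_cast (by omega : 1 ≤ d)
  · intro x hx
    exact hgood x hx.1 hx.2
  · set T : ℝ := 2 ^ (-β * (K : ℝ)) with hT
    have hT0 : 0 < T := by positivity
    have hVT : V = T ^ p := by
      rw [hV, hT, ← Real.rpow_mul (by norm_num)]; congr 1; ring
    rw [hVT] at hvol
    have key := lp_bound d (fun x => f x - ft x) (badSet d K δ) (measurableSet_badSet d K δ)
      p T Q (2 * B) hp hT0.le hQ.le (by positivity) hvol (by
        intro x hx
        have h1 := hfB x hx
        have h2 := hftB x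
        have h3 := abs_sub (f x) (ft x)
        show |f x - ft x| ≤ _
        linarith) (by
        intro x hx hxE
        show |f x - ft x| ≤ _
        rw [hgood x hx hxE, htv _ (hxa x hx).1]
        refine (hf x hx _ (hdec _ fun q j => truncD_le K _ ((hxa x hx).1 q) j)).trans ?_
        refine mul_le_mul_of_nonneg_left ?_ hQ.le
        have h1 : ‖x - fun q => binVal (truncD K (a (x q)))‖ ≤ (1 / 2 : ℝ) ^ K := by
          rw [pi_norm_le_iff_of_nonneg (by positivity)]
          intro q
          have := binVal_trunc K (a (x q)) ((hxa x hx).1 q)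
          rw [← (hxa x hx).2 q] at this
          exact this
        refine (Real.rpow_le_rpow (norm_nonneg _) h1 hβ0.le).trans (le_of_eq ?_)
        rw [hT, one_div, inv_pow, ← Real.rpow_natCast, ← Real.rpow_neg (by norm_num),
          ← Real.rpow_mul (by norm_num)]
        congr 1; ring)
    refine key.trans (mul_le_mul_of_nonneg_right ?_ hT0.le)
    linarith

end
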